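/- Let R be a Gorenstein local ring and I an ideal with β_1^R(I) - β_0^R(I) = -1, β_1^R(I) ≠ 0, and grade(I) = 1. Then the unmixed part I^unm of I is a principal ideal generated by a nonzerodivisor; in particular I ≠ I^unm. -/

import Mathlib

open CategoryTheory IsLocalRing RingTheory.Sequence

noncomputable section

variable (R : Type) [CommRing R]

/-- `Tor_n^R(M, N)` as an object of `ModuleCat R`. -/
def TorM (n : ℕ) (M N : ModuleCat R) : ModuleCat R :=
  ((Tor (ModuleCat R) n).obj M).obj N

/-- `Ext_R^n(M, N)` as an object of `ModuleCat R`. -/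
def ExtM (n : ℕ) (M N : ModuleCat R) : ModuleCat R :=
  ((Ext R (ModuleCat R) n).obj (Opposite.op M)).obj N

/-- `b` is the `j`-th Betti number of `M`, i.e. `Tor_j(k, M) ≅ k^b`. -/
def HasBetti [IsLocalRing R] (M : ModuleCat R) (j b : ℕ) : Prop :=
  Nonempty (TorM R j (ModuleCat.of R (ResidueField R)) M ≅
    ModuleCat.of R (Fin b → ResidueField R))

/-- `b` is the `j`-th Bass number of `M`, i.e. `Ext^j(k, M) ≅ k^b`. -/
def HasBass [IsLocalRing R] (M : ModuleCat R) (j b : ℕ) : Prop :=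
  Nonempty (ExtM R j (ModuleCat.of R (ResidueField R)) M ≅
    ModuleCat.of R (Fin b → ResidueField R))

/-- Projective dimension at most `n`: all `Ext^m(M, -)` vanish for `m > n`. -/
def ProjDimLE (M : ModuleCat R) (n : ℕ) : Prop :=
  ∀ m > n, ∀ N : ModuleCat R, Limits.IsZero (ExtM R m M N)

def ProjDimEq (M : ModuleCat R) (n : ℕ) : Prop :=
  ProjDimLE R M n ∧ ∀ m : ℕ, ProjDimLE R M m → n ≤ m

/-- The ideal `I` contains a regular sequence of length `g`. -/
def GradeGE (I : Ideal R) (g : ℕ) : Prop :=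
  ∃ rs : List R, rs.length = g ∧ (∀ x ∈ rs, x ∈ I) ∧ IsRegular R rs

/-- `grade I = g`. -/
def GradeEq (I : Ideal R) (g : ℕ) : Prop :=
  GradeGE R I g ∧ ∀ rs : List R, (∀ x ∈ rs, x ∈ I) → IsRegular R rs → rs.length ≤ g

/-- The height of a prime ideal, as the Krull dimension of the localization. -/
def primeHt (p : Ideal R) [p.IsPrime] : WithBot (WithTop ℕ) :=
  ringKrullDim (Localization.AtPrime p)

/-- The height of an ideal: the infimum of heights of minimal primes over it. -/
def idealHt (I : Ideal R) : WithBot (WithTop ℕ) :=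
  sInf { h | ∃ p : PrimeSpectrum R, p.asIdeal ∈ I.minimalPrimes ∧
    ringKrullDim (Localization.AtPrime p.asIdeal) = h }

/-- The `p`-primary component of `I` (contraction of the extension to `R_p`). -/
def primaryComponent (I p : Ideal R) [p.IsPrime] : Ideal R :=
  (I.map (algebraMap R (Localization.AtPrime p))).comap
    (algebraMap R (Localization.AtPrime p))

/-- The unmixed part of `I`: intersection of the primary components at the
minimal primes of minimal height. -/
def unmixedPart (I : Ideal R) : Ideal R :=
  ⨅ p : { p : PrimeSpectrum R // p.asIdeal ∈ I.minimalPrimes ∧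
      ringKrullDim (Localization.AtPrime p.asIdeal) = idealHt R I },
    primaryComponent R I p.1.asIdeal

/-- The quotient `R ⧸ J` is a Cohen-Macaulay module over the local ring `R`. -/
def IsCMQuot [IsLocalRing R] (J : Ideal R) : Prop :=
  ∃ rs : List R, (∀ x ∈ rs, x ∈ maximalIdeal R) ∧ IsRegular (R ⧸ J) rs ∧
    (rs.length : WithBot (WithTop ℕ)) = ringKrullDim (R ⧸ J)

/-- A Cohen-Macaulay local ring. -/
def IsCMLocalRing [IsLocalRing R] : Prop := IsCMQuot R ⊥

/-- A Gorenstein local ring: Cohen-Macaulay of type 1. -/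
def IsGorensteinLocalRing [IsLocalRing R] : Prop :=
  IsCMLocalRing R ∧ ∃ d : ℕ, (d : WithBot (WithTop ℕ)) = ringKrullDim R ∧
    HasBass R (ModuleCat.of R R) d 1

/-- `M` has rank `r`: `M ⊗ Q` is free of rank `r` over the total quotient ring `Q`. -/
def HasRank (M : Type) [AddCommGroup M] [Module R M] (r : ℕ) : Prop :=
  Nonempty (LocalizedModule (nonZeroDivisors R) M ≃ₗ[Localization (nonZeroDivisors R)]
    (Fin r → Localization (nonZeroDivisors R)))

end


lemma isAssociatedPrime_quotient_iff {R : Type*} [CommRing R] [IsNoetherianRing R]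
    {I p : Ideal R} :
    IsAssociatedPrime p (R ⧸ I) ↔ p.IsPrime ∧ ∃ s : R, ∀ r, r ∈ p ↔ r * s ∈ I := by
  rw [isAssociatedPrime_iff]
  refine and_congr_right fun _ ↦ ⟨?_, ?_⟩
  · rintro ⟨x, hx⟩
    obtain ⟨s, rfl⟩ := Ideal.Quotient.mk_surjective x
    refine ⟨s, fun r ↦ ?_⟩
    rw [hx, Submodule.mem_colon_singleton, Submodule.mem_bot, ← Ideal.Quotient.eq_zero_iff_mem]
    rfl
  · rintro ⟨s, hs⟩
    refine ⟨Ideal.Quotient.mk I s, ?_⟩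
    ext r
    rw [hs, Submodule.mem_colon_singleton, Submodule.mem_bot, ← Ideal.Quotient.eq_zero_iff_mem]
    rfl

open scoped Pointwise in
/-- A finite `R`-module with a regular sequence of length `n` in the maximal ideal has only
associated primes of coheight at least `n`. -/
lemma length_le_coheight_of_isAssociatedPrime {R : Type*} [CommRing R] [IsNoetherianRing R]
    [IsLocalRing R] (rs : List R) : ∀ {M : Type*} [AddCommGroup M] [Module R M] [Module.Finite R M],
    (∀ r ∈ rs, r ∈ maximalIdeal R) → IsRegular M rs → ∀ p : PrimeSpectrum R,
    IsAssociatedPrime p.asIdeal M → (rs.length : ℕ∞) ≤ Order.coheight p := by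
  induction rs with
  | nil => intros; simp
  | cons x rs ih =>
    intro M _ _ _ hmem hreg p hp
    rw [isRegular_cons_iff] at hreg
    simp only [List.mem_cons, forall_eq_or_imp] at hmem
    obtain ⟨-, m, hm⟩ := isAssociatedPrime_iff.mp hp
    have hp' (r : R) : r ∈ p.asIdeal ↔ r • m = 0 := by
      rw [hm, Submodule.mem_colon_singleton, Submodule.mem_bot]
    have hxp : x ∉ p.asIdeal := fun h ↦ p.2.ne_top <| (Ideal.eq_top_iff_one _).mpr <| by
      rw [hp', one_smul]
      exact hreg.1.right_eq_zero_of_smul ((hp' x).mp h)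
    let N : Submodule R M := Submodule.torsionBySet R M p.asIdeal
    have hmN : m ∈ N := by
      rw [Submodule.mem_torsionBySet_iff]
      exact fun a ↦ (hp' a).mp a.2
    have hN : ¬ N ≤ x • (⊤ : Submodule R M) := by
      intro hle
      have hNx : N ≤ (Ideal.span {x}) • N := by
        intro n hn
        obtain ⟨y, -, rfl⟩ := (Submodule.mem_smul_pointwise_iff_exists ..).mp (hle hn)
        refine Submodule.smul_mem_smul (Ideal.mem_span_singleton_self x) ?_
        rw [Submodule.mem_torsionBySet_iff] at hn ⊢
        intro a
        refine hreg.1.right_eq_zero_of_smul ?_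
        rw [smul_comm]
        exact hn a
      have hbot : N = ⊥ := Submodule.eq_bot_of_le_smul_of_le_jacobson_bot _ N
        (IsNoetherian.noetherian N) hNx (by
          rw [IsLocalRing.jacobson_eq_maximalIdeal _ bot_ne_top]
          simpa [Ideal.span_singleton_le_iff_mem] using hmem.1)
      rw [hbot, Submodule.mem_bot] at hmN
      exact p.2.ne_top ((Ideal.eq_top_iff_one _).mpr ((hp' 1).mpr (by simp [hmN])))
    obtain ⟨n, hnN, hnx⟩ := Set.not_subset.mp hN
    obtain ⟨q, hq, hle⟩ := exists_le_isAssociatedPrime_of_isNoetherianRing R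
      (M := QuotSMulTop x M) (Submodule.Quotient.mk n)
      (by rw [Ne, Submodule.Quotient.mk_eq_zero]; exact hnx)
    have hcol (r : R) (hr : r • n ∈ x • (⊤ : Submodule R M)) : r ∈ q := by
      apply hle
      rw [Submodule.mem_colon_singleton, Submodule.mem_bot, ← Submodule.Quotient.mk_smul,
        Submodule.Quotient.mk_eq_zero]
      exact hr
    have hlt : p < ⟨q, hq.isPrime⟩ := by
      refine lt_of_le_of_ne (fun r hr ↦ hcol r ?_) fun h ↦ hxp ?_
      · rw [(Submodule.mem_torsionBySet_iff _ _).mp hnN ⟨r, hr⟩]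
        exact zero_mem _
      · rw [h]
        exact hcol x (Submodule.smul_mem_pointwise_smul _ _ _ trivial)
    have := ih hmem.2 hreg.2 ⟨q, hq.isPrime⟩ hq
    refine le_trans ?_ (Order.coheight_add_one_le hlt)
    push_cast [List.length_cons]
    gcongr

/-- Cutting down by a regular element shortens maximal regular sequences by at most one. -/
lemma exists_isRegular_quotSMulTop {R : Type} [CommRing R] [IsNoetherianRing R]
    [IsLocalRing R] {a : R} (ha : a ∈ maximalIdeal R) (hreg : IsSMulRegular R a)
    {n : ℕ} {rs : List R} (hlen : rs.length = n + 1) (hmem : ∀ r ∈ rs, r ∈ maximalIdeal R)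
    (hrs : IsRegular R rs) :
    ∃ ts : List R, ts.length = n ∧ (∀ r ∈ ts, r ∈ maximalIdeal R) ∧
      IsRegular (QuotSMulTop a R) ts := by
  have : Nontrivial (QuotSMulTop a R) := nontrivial_quotSMulTop_of_mem_maximalIdeal R ha
  have hlt (M : ModuleCat.{0} R) [Module.Finite R M] [Nontrivial M] :
      maximalIdeal R • (⊤ : Submodule R M) < ⊤ :=
    lt_top_iff_ne_top.mpr (Submodule.top_ne_ideal_smul_of_le_jacobson_annihilator
      (IsLocalRing.maximalIdeal_le_jacobson _)).symm
  have htfae₁ := ModuleCat.exists_isRegular_tfae (maximalIdeal R) (n + 1) (ModuleCat.of R R) (hlt _)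
  have hiff := htfae₁.out 3 1
  have h₁ := hiff.mp ⟨rs, hlen, hmem, hrs⟩
  have htfae₂ := ModuleCat.exists_isRegular_tfae (maximalIdeal R) n
    (ModuleCat.of R (QuotSMulTop a R)) (hlt _)
  refine (htfae₂.out 3 1).mpr fun i hi ↦ ?_
  have zero1 := AddCommGrpCat.isZero_of_iff_subsingleton.mpr (h₁ i (by omega))
  have zero2 := AddCommGrpCat.isZero_of_iff_subsingleton.mpr (h₁ (i + 1) (by omega))
  have hreg' : IsSMulRegular (ModuleCat.of R R) a := hreg
  exact AddCommGrpCat.subsingleton_of_isZero <| ShortComplex.Exact.isZero_of_both_zeros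
    ((Abelian.Ext.covariant_sequence_exact₃' _ hreg'.smulShortComplex_shortExact) i (i + 1) rfl)
    (zero1.eq_zero_of_src _) (zero2.eq_zero_of_tgt _)

open scoped Pointwise in
/-- In a Cohen-Macaulay local ring, principal ideals generated by a nonzerodivisor are unmixed. -/
lemma height_le_one_of_isAssociatedPrime_quotient_span {R : Type} [CommRing R]
    [IsNoetherianRing R] [IsLocalRing R] (hR : IsCMLocalRing R) {a : R}
    (ha : a ∈ nonZeroDivisors R) {p : Ideal R} [p.IsPrime]
    (hp : IsAssociatedPrime p (R ⧸ Ideal.span {a})) : p.height ≤ 1 := by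
  have hap : a ∈ p := by
    obtain ⟨-, s, hs⟩ := isAssociatedPrime_quotient_iff.mp hp
    exact (hs a).mpr (Ideal.mul_mem_right _ _ (Ideal.mem_span_singleton_self a))
  obtain ⟨rs, hmem, hreg, hdim⟩ := hR
  have e : (R ⧸ (⊥ : Ideal R)) ≃ₗ[R] R := (Submodule.quotEquivOfEqBot ⊥ rfl)
  rw [ringKrullDim_eq_of_ringEquiv (RingEquiv.quotientBot R)] at hdim
  replace hreg := (e.isRegular_congr rs).mp hreg
  have hareg : IsSMulRegular R a := Module.Flat.isSMulRegular_of_nonZeroDivisors ha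
  have ham : a ∈ maximalIdeal R := IsLocalRing.le_maximalIdeal ‹p.IsPrime›.ne_top hap
  have key : (rs.length : ℕ∞) ≤ Order.coheight (⟨p, inferInstance⟩ : PrimeSpectrum R) + 1 := by
    rcases h : rs.length with _ | n
    · simp
    · obtain ⟨ts, hts, htm, htreg⟩ := exists_isRegular_quotSMulTop ham hareg h hmem hreg
      have hspan : Ideal.span {a} = a • (⊤ : Ideal R) := by
        simp [← Submodule.ideal_span_singleton_smul]
      have := length_le_coheight_of_isAssociatedPrime ts htm htreg ⟨p, inferInstance⟩
        ((LinearEquiv.isAssociatedPrime_iff (Submodule.quotEquivOfEq _ _ hspan)).mp hp)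
      push_cast
      rw [hts] at this
      gcongr
  have hsum : p.height + Order.coheight (⟨p, inferInstance⟩ : PrimeSpectrum R)
      ≤ (rs.length : ℕ∞) := by
    rw [← WithBot.coe_le_coe]
    change _ ≤ ((rs.length : WithBot ℕ∞))
    have h := hdim
    rw [ringKrullDim, Order.krullDim_eq_iSup_height_add_coheight_of_nonempty] at h
    refine le_trans ?_ h.ge
    rw [WithBot.coe_le_coe]
    refine le_trans ?_ (le_iSup _ (⟨p, inferInstance⟩ : PrimeSpectrum R))
    rw [← PrimeSpectrum.height_eq_orderHeight]
  have hfin : Order.coheight (⟨p, inferInstance⟩ : PrimeSpectrum R) ≠ ⊤ :=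
    ne_top_of_le_ne_top (ENat.natCast_ne_top rs.length) (le_trans le_add_self hsum)
  rw [← ENat.add_le_add_iff_right hfin]
  rw [add_comm 1]
  exact hsum.trans key

lemma updateRow_zero_of_cons {A : Type*} {n m : ℕ} (w : Fin n → Fin m → A) (c x : Fin m → A) :
    (Matrix.of (Fin.cons c w : Fin (n + 1) → Fin m → A)).updateRow 0 x =
      Matrix.of (Fin.cons x w : Fin (n + 1) → Fin m → A) := by
  ext a b
  refine Fin.cases ?_ (fun a ↦ ?_) a <;> simp

/-- The linear form `c ↦ det (c, w₁, …, wₙ)`, whose coordinates are the signed maximal minors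
of the matrix with rows `w₁, …, wₙ`. -/
def signedMinors {A : Type*} [CommRing A] {n : ℕ} (w : Fin n → Fin (n + 1) → A) :
    (Fin (n + 1) → A) →ₗ[A] A where
  toFun c := Matrix.det (Matrix.of (Fin.cons c w : Fin (n + 1) → Fin (n + 1) → A))
  map_add' x y := by
    simpa only [updateRow_zero_of_cons] using
      Matrix.det_updateRow_add (Matrix.of (Fin.cons 0 w : Fin (n + 1) → _)) 0 x y
  map_smul' r x := by
    simpa only [updateRow_zero_of_cons, smul_eq_mul, RingHom.id_apply] using
      Matrix.det_updateRow_smul (Matrix.of (Fin.cons 0 w : Fin (n + 1) → _)) 0 r x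

lemma signedMinors_apply {A : Type*} [CommRing A] {n : ℕ} (w : Fin n → Fin (n + 1) → A)
    (c : Fin (n + 1) → A) :
    signedMinors w c = Matrix.det (Matrix.of (Fin.cons c w : Fin (n + 1) → Fin (n + 1) → A)) :=
  rfl

lemma map_signedMinors {A B : Type*} [CommRing A] [CommRing B] (g : A →+* B) {n : ℕ}
    (w : Fin n → Fin (n + 1) → A) (c : Fin (n + 1) → A) :
    g (signedMinors w c) = signedMinors (fun j ↦ g ∘ w j) (g ∘ c) := by
  rw [signedMinors_apply, RingHom.map_det, signedMinors_apply]
  congr 1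
  ext i j
  refine Fin.cases ?_ (fun i ↦ ?_) i <;> simp

/-- A linear form vanishing on `w₁, …, wₙ` is proportional to the form of signed minors. -/
lemma signedMinors_mul_eq {A : Type*} [CommRing A] {n : ℕ} {w : Fin n → Fin (n + 1) → A}
    {f : (Fin (n + 1) → A) →ₗ[A] A} (hf : ∀ j, f (w j) = 0) (c v : Fin (n + 1) → A) :
    signedMinors w c * f v = f c * signedMinors w v := by
  suffices h : signedMinors w c • f = f c • signedMinors w from congr($h v)
  refine LinearMap.pi_ext' fun i ↦ LinearMap.ext_ring ?_
  let M : Matrix (Fin (n + 1)) (Fin (n + 1)) A := Matrix.of (Fin.cons c w)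
  let F : Fin (n + 1) → A := fun i ↦ f (Pi.single i 1)
  have hF (u : Fin (n + 1) → A) : u ⬝ᵥ F = f u := by
    conv_rhs => rw [pi_eq_sum_univ' u, map_sum]
    simp [dotProduct, F]
  have hMF : M.mulVec F = Pi.single 0 (f c) := by
    ext j
    refine Fin.cases ?_ (fun j ↦ ?_) j
    · exact (hF c).trans (by simp)
    · exact (hF (w j)).trans (by simp [hf])
  have h := congr($(Matrix.mulVec_mulVec F M.adjugate M) i)
  rw [hMF, Matrix.adjugate_mul, Matrix.smul_mulVec, Matrix.one_mulVec, Matrix.mulVec_single,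
    Pi.smul_apply, Matrix.col_apply, Matrix.adjugate_apply] at h
  rw [updateRow_zero_of_cons] at h
  simpa [signedMinors_apply, M, F, mul_comm] using h.symm

/-- If `f c` is a nonzerodivisor and `w₁, …, wₙ` span the kernel of the linear form `f`, then
`det (c, w₁, …, wₙ)` is a nonzerodivisor. -/
lemma signedMinors_mem_nonZeroDivisors {A : Type*} [CommRing A] {n : ℕ}
    {w : Fin n → Fin (n + 1) → A} {f : (Fin (n + 1) → A) →ₗ[A] A}
    (hker : LinearMap.ker f ≤ Submodule.span A (Set.range w))
    {c : Fin (n + 1) → A} (hc : f c ∈ nonZeroDivisors A) :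
    signedMinors w c ∈ nonZeroDivisors A := by
  let M : Matrix (Fin (n + 1)) (Fin (n + 1)) A := Matrix.of (Fin.cons c w)
  have hex (v : Fin (n + 1) → A) : ∃ t : Fin (n + 1) → A, Matrix.vecMul t M = f c • v := by
    have hmem : f c • v - f v • c ∈ LinearMap.ker f := by simp [mul_comm]
    obtain ⟨t, ht⟩ := (Submodule.mem_span_range_iff_exists_fun A).mp (hker hmem)
    refine ⟨Fin.cons (f v) t, ?_⟩
    rw [Matrix.vecMul_eq_sum, Fin.sum_univ_succ]
    simp only [Fin.cons_zero, Fin.cons_succ]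
    have : ∑ i, t i • M i.succ = ∑ i, t i • w i := rfl
    rw [this, ht]
    change f v • c + _ = _
    abel
  choose N hN using fun i : Fin (n + 1) ↦ hex (Pi.single i 1)
  have hNM : Matrix.of N * M = f c • (1 : Matrix (Fin (n + 1)) (Fin (n + 1)) A) := by
    ext i j
    have := congr($(hN i) j)
    rw [Matrix.mul_apply_eq_vecMul]
    refine this.trans ?_
    simp [Matrix.one_apply, Pi.single_apply, eq_comm]
  have hdet := congr(Matrix.det $hNM)
  rw [Matrix.det_mul, Matrix.det_smul, Matrix.det_one, mul_one] at hdet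
  have hmem : (Matrix.of N).det * M.det ∈ nonZeroDivisors A := hdet ▸ pow_mem hc _
  exact (mul_mem_nonZeroDivisors.mp hmem).2

lemma exists_sum_smul_eq_zero_of_signedMinors_eq_zero {D : Type*} [CommRing D] [IsDomain D] {n : ℕ}
    {w : Fin n → Fin (n + 1) → D} (h : signedMinors w = 0) :
    ∃ r : Fin n → D, ∑ j, r j • w j = 0 ∧ ∃ j, r j ≠ 0 := by
  let K := FractionRing D
  let g : D →+* K := algebraMap D K
  let w' : Fin n → Fin (n + 1) → K := fun j ↦ g ∘ w j
  have hw' : signedMinors w' = 0 := by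
    refine LinearMap.pi_ext' fun i ↦ LinearMap.ext_ring ?_
    have := map_signedMinors g w (Pi.single i 1)
    rw [h] at this
    have hs : g ∘ (Pi.single i 1 : Fin (n + 1) → D) = Pi.single i 1 := by
      ext j; simp [Pi.single_apply, apply_ite g]
    rw [hs] at this
    simpa using this.symm
  have hdep : ¬ LinearIndependent K w' := by
    intro hli
    have hne : Submodule.span K (Set.range w') ≠ ⊤ := by
      intro htop
      have := finrank_range_le_card (R := K) w'
      rw [Set.finrank, htop, finrank_top, Module.finrank_fin_fun, Fintype.card_fin] at this
      omega
    obtain ⟨x, hx⟩ := SetLike.exists_not_mem_of_ne_top _ hne rfl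
    have hli' := LinearIndependent.finCons hli hx
    have hu := Matrix.linearIndependent_rows_iff_isUnit
      (A := Matrix.of (Fin.cons x w' : Fin (n + 1) → Fin (n + 1) → K)).mp hli'
    rw [Matrix.isUnit_iff_isUnit_det, ← signedMinors_apply, hw'] at hu
    simp at hu
  have hdepD : ¬ LinearIndependent D w := by
    intro hli
    refine hdep ((LinearIndependent.iff_fractionRing D K).mp ?_)
    have hinj : Function.Injective ((Algebra.linearMap D K).compLeft (Fin (n + 1))) := by
      intro a b hab
      ext i
      exact FaithfulSMul.algebraMap_injective D K congr($hab i)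
    exact hli.map' _ (LinearMap.ker_eq_bot.mpr hinj)
  obtain ⟨r, hr, hj⟩ := Fintype.not_linearIndependent_iff.mp hdepD
  exact ⟨r, hr, hj⟩

/-- **Hilbert–Burch**: a linear form on `A ^ (n + 1)` whose image contains a nonzerodivisor and
whose kernel is spanned by `n` vectors is a nonzerodivisor multiple of the form of signed minors,
and the ideal of minors has grade at least two. -/
theorem exists_eq_smul_signedMinors {A : Type*} [CommRing A] [IsNoetherianRing A] {n : ℕ}
    {w : Fin n → Fin (n + 1) → A} {f : (Fin (n + 1) → A) →ₗ[A] A}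
    (hker : LinearMap.ker f = Submodule.span A (Set.range w))
    {c : Fin (n + 1) → A} (hc : f c ∈ nonZeroDivisors A) :
    ∃ a ∈ nonZeroDivisors A, f = a • signedMinors w ∧
      ∃ x ∈ LinearMap.range (signedMinors w), x ∈ nonZeroDivisors A ∧
        ∃ y ∈ LinearMap.range (signedMinors w), IsSMulRegular (A ⧸ Ideal.span {x}) y := by
  have hw (j) : f (w j) = 0 := by
    rw [← LinearMap.mem_ker, hker]
    exact Submodule.subset_span ⟨j, rfl⟩
  have hx : signedMinors w c ∈ nonZeroDivisors A :=
    signedMinors_mem_nonZeroDivisors hker.le hc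
  set x := signedMinors w c with hxdef
  have hli (r : Fin n → A) (hr : ∑ j, r j • w j = 0) : r = 0 := by
    let M : Matrix (Fin (n + 1)) (Fin (n + 1)) A := Matrix.of (Fin.cons c w)
    have h0 : Matrix.vecMul (Fin.cons 0 r : Fin (n + 1) → A) M = 0 := by
      rw [Matrix.vecMul_eq_sum, Fin.sum_univ_succ, Fin.cons_zero, zero_smul, zero_add]
      exact hr
    have h1 := Matrix.vecMul_vecMul (Fin.cons 0 r : Fin (n + 1) → A) M M.adjugate
    rw [h0, Matrix.zero_vecMul, Matrix.mul_adjugate, Matrix.vecMul_smul, Matrix.vecMul_one] at h1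
    ext j
    have h2 := congr($h1 j.succ)
    simp only [Pi.zero_apply, Pi.smul_apply, Fin.cons_succ, smul_eq_mul] at h2
    exact (mul_left_mem_nonZeroDivisors_eq_zero_iff hx).mp h2.symm
  have hass : ∀ p : Ideal A, IsAssociatedPrime p (A ⧸ Ideal.span {x}) →
      ¬ LinearMap.range (signedMinors w) ≤ p := by
    intro p hp hle
    obtain ⟨hprime, s, hs⟩ := isAssociatedPrime_quotient_iff.mp hp
    let g := Ideal.Quotient.mk p
    have hzero : signedMinors (fun j ↦ g ∘ w j) = 0 := by
      refine LinearMap.pi_ext' fun i ↦ LinearMap.ext_ring ?_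
      have := map_signedMinors g w (Pi.single i 1)
      have hsg : g ∘ (Pi.single i 1 : Fin (n + 1) → A) = Pi.single i 1 := by
        ext j; simp [Pi.single_apply, apply_ite g]
      rw [hsg, Ideal.Quotient.eq_zero_iff_mem.mpr (hle ⟨_, rfl⟩)] at this
      simpa using this.symm
    obtain ⟨r, hr, j₀, hj₀⟩ := exists_sum_smul_eq_zero_of_signedMinors_eq_zero hzero
    choose r' hr' using fun j ↦ Ideal.Quotient.mk_surjective (r j)
    have hmem (i) : (∑ j, r' j • w j) i ∈ p := by
      rw [← Ideal.Quotient.eq_zero_iff_mem]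
      have := congr($hr i)
      simpa [← hr', g] using this
    choose v hv using fun i ↦ Ideal.mem_span_singleton'.mp ((hs _).mp (hmem i))
    have hv' : x • v = ∑ j, (s * r' j) • w j := by
      ext i
      simp only [Pi.smul_apply, smul_eq_mul, mul_comm x, hv, mul_smul, ← Finset.smul_sum]
      ring
    have hfv : f v = 0 := by
      have := congr(f $hv')
      simp only [map_smul, map_sum, hw, smul_eq_mul, mul_zero, Finset.sum_const_zero] at this
      exact (mul_left_mem_nonZeroDivisors_eq_zero_iff hx).mp this
    rw [← LinearMap.mem_ker, hker] at hfv
    obtain ⟨t, rfl⟩ := (Submodule.mem_span_range_iff_exists_fun A).mp hfv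
    have := hli (fun j ↦ s * r' j - x * t j) (by
      rw [← sub_eq_zero.mpr hv'.symm]
      simp only [sub_smul, Finset.sum_sub_distrib, mul_smul, ← Finset.smul_sum])
    refine hj₀ ?_
    rw [← hr', Ideal.Quotient.eq_zero_iff_mem, hs, Ideal.mem_span_singleton']
    have h := congr_fun this j₀
    simp only [Pi.zero_apply] at h
    exact ⟨t j₀, by linear_combination -h⟩
  obtain ⟨y, hy, hyreg⟩ : ∃ y ∈ LinearMap.range (signedMinors w),
      IsSMulRegular (A ⧸ Ideal.span {x}) y := by
    by_contra! hcon
    have hsub : ((LinearMap.range (signedMinors w) : Ideal A) : Set A) ⊆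
        ⋃ p ∈ associatedPrimes A (A ⧸ Ideal.span {x}), ((id p : Ideal A) : Set A) := by
      simp only [id]
      rw [biUnion_associatedPrimes_eq_compl_regular]
      exact hcon
    obtain ⟨p, hp, hle⟩ := (Ideal.subset_union_prime_finite (f := id)
      (associatedPrimes.finite _ _) ⊥ ⊥ fun p hp _ _ ↦ hp.isPrime).mp hsub
    exact hass p hp hle
  rw [isSMulRegular_quotient_iff_mem_of_smul_mem] at hyreg
  obtain ⟨d, hd⟩ := hy
  have hcd : x * f d = f c * y := by rw [← hd]; exact signedMinors_mul_eq hw c d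
  obtain ⟨a, ha⟩ := Ideal.mem_span_singleton'.mp (hyreg (f c) (by
    rw [smul_eq_mul, mul_comm, ← hcd]
    exact Ideal.mul_mem_right _ _ (Ideal.mem_span_singleton_self x)))
  have hfa : f = a • signedMinors w := by
    ext1 i
    refine LinearMap.ext_ring ?_
    have := signedMinors_mul_eq hw c (Pi.single i 1)
    refine (mul_cancel_left_mem_nonZeroDivisors hx).mp (this.trans ?_)
    simp [← ha]
    ring
  refine ⟨a, ?_, hfa, x, ⟨c, rfl⟩, hx, y, ⟨d, hd⟩,
    (isSMulRegular_quotient_iff_mem_of_smul_mem _ _).mpr hyreg⟩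
  rw [← ha] at hc
  exact (mul_mem_nonZeroDivisors.mp hc).1


open scoped TensorProduct in
/-- Nakayama: generators of `k ⊗ N` lift to generators of `N`. -/
lemma exists_span_range_eq_top_of_surjective {R : Type*} [CommRing R] [IsLocalRing R]
    {N : Type*} [AddCommGroup N] [Module R N] [Module.Finite R N] {b : ℕ}
    (s : (Fin b → ResidueField R) →ₗ[R] ResidueField R ⊗[R] N) (hs : Function.Surjective s) :
    ∃ n : Fin b → N, (∀ i, s (Pi.single i 1) = 1 ⊗ₜ n i) ∧
      Submodule.span R (Set.range n) = ⊤ := by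
  choose n hn using fun i ↦
    TensorProduct.mk_surjective R N (ResidueField R) residue_surjective (s (Pi.single i 1))
  refine ⟨n, fun i ↦ (hn i).symm, ?_⟩
  rw [← IsLocalRing.map_tensorProduct_mk_eq_top, eq_top_iff]
  rintro t -
  obtain ⟨u, rfl⟩ := hs t
  choose r hr using fun i ↦ residue_surjective (u i)
  refine ⟨∑ i, r i • n i, sum_mem fun i _ ↦ Submodule.smul_mem _ _
    (Submodule.subset_span ⟨i, rfl⟩), ?_⟩
  have hu : u = ∑ i, r i • (Pi.single i 1 : Fin b → ResidueField R) := by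
    ext j
    simp [Finset.sum_apply, Pi.single_apply, Algebra.smul_def, ← hr]
  rw [hu]
  simp only [map_sum, map_smul, hn]

/-- If `b₀ = dim Tor₀(k, M)`, then `M` has a minimal system of `b₀` generators. -/
lemma exists_minimal_generators {R : Type} [CommRing R] [IsLocalRing R]
    {M : ModuleCat.{0} R} [Module.Finite R M] {b : ℕ} (h : HasBetti R M 0 b) :
    ∃ π : (Fin b → R) →ₗ[R] M, Function.Surjective π ∧
      ∀ v ∈ LinearMap.ker π, ∀ i, v i ∈ maximalIdeal R := by
  obtain ⟨e⟩ := h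
  let e' : (Fin b → ResidueField R) ≃ₗ[R] TensorProduct R (ResidueField R) M :=
    (e.symm ≪≫ (Functor.leftDerivedZeroIsoSelf ((MonoidalCategory.tensoringLeft
      (ModuleCat R)).obj (ModuleCat.of R (ResidueField R)))).app M).toLinearEquiv
  obtain ⟨n, hn, hspan⟩ := exists_span_range_eq_top_of_surjective e'.toLinearMap e'.surjective
  refine ⟨Fintype.linearCombination R n, ?_, fun v hv i ↦ ?_⟩
  · rw [← LinearMap.range_eq_top, Fintype.range_linearCombination, hspan]
  · have h0 : e' (∑ i, v i • (Pi.single i 1 : Fin b → ResidueField R)) = 0 := by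
      rw [LinearMap.mem_ker, Fintype.linearCombination_apply] at hv
      have hn' (i) : e' (Pi.single i 1) = TensorProduct.mk R (ResidueField R) M 1 (n i) := hn i
      simp only [map_sum, map_smul, hn']
      simpa only [map_sum, map_smul, map_zero] using
        congr(TensorProduct.mk R (ResidueField R) M 1 $hv)
    rw [LinearEquiv.map_eq_zero_iff] at h0
    have := congr($h0 i)
    rw [← residue_eq_zero_iff]
    simpa [Finset.sum_apply, Pi.single_apply, Algebra.smul_def] using this

open scoped TensorProduct in
lemma lTensor_residueField_eq_zero {R : Type*} [CommRing R] [IsLocalRing R]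
    {N : Type*} [AddCommGroup N] [Module R N] {b : ℕ} (g : (Fin b → R) →ₗ[R] N)
    {v : Fin b → R} (hv : ∀ i, v i ∈ maximalIdeal R) :
    (1 : ResidueField R) ⊗ₜ[R] g v = 0 := by
  rw [pi_eq_sum_univ' v, map_sum, TensorProduct.tmul_sum]
  refine Finset.sum_eq_zero fun i _ ↦ ?_
  rw [map_smul, ← TensorProduct.smul_tmul, Algebra.smul_def, mul_one, ResidueField.algebraMap_eq,
    (residue_eq_zero_iff _).mpr (hv i), TensorProduct.zero_tmul]

open scoped TensorProduct in
/-- For a minimal cover `π : Rᵇ → M`, the module `Tor₁(k, M)` surjects onto `k ⊗ ker π`. -/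
lemma exists_surjective_torM_one {R : Type} [CommRing R] [IsLocalRing R]
    {M : ModuleCat.{0} R} {b : ℕ} (π : (Fin b → R) →ₗ[R] M) (hπ : Function.Surjective π)
    (hmin : ∀ v ∈ LinearMap.ker π, ∀ i, v i ∈ maximalIdeal R) :
    ∃ s : TorM R 1 (ModuleCat.of R (ResidueField R)) M →ₗ[R]
      TensorProduct R (ResidueField R) (LinearMap.ker π), Function.Surjective s := by
  let P := projectiveResolution M
  let F := (MonoidalCategory.tensoringLeft (ModuleCat.{0} R)).obj
    (ModuleCat.of R (ResidueField R))
  let C := (F.mapHomologicalComplex _).obj P.complex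
  let e : TorM R 1 (ModuleCat.of R (ResidueField R)) M ≅ C.homology 1 :=
    P.isoLeftDerivedObj F 1
  have : Module.Projective R (P.complex.X 0) :=
    (IsProjective.iff_projective _).mpr (P.projective 0)
  obtain ⟨g₀, hg₀⟩ := Module.projective_lifting_property π (P.π.f 0).hom hπ
  obtain ⟨h, hh⟩ := Module.projective_lifting_property (P.π.f 0).hom π
    ((ModuleCat.epi_iff_surjective _).mp inferInstance)
  replace hg₀ (p : P.complex.X 0) : π (g₀ p) = (P.π.f 0).hom p := congr($hg₀ p)
  replace hh (v : Fin b → R) : (P.π.f 0).hom (h v) = π v := congr($hh v)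
  let g₁ : P.complex.X 1 →ₗ[R] LinearMap.ker π :=
    (g₀ ∘ₗ (P.complex.d 1 0).hom).codRestrict _ fun p ↦ by
      rw [LinearMap.mem_ker, LinearMap.comp_apply, hg₀]
      exact congr(($(P.complex_d_comp_π_f_zero)).hom p)
  let ψ : C.X 1 ⟶ ModuleCat.of R (TensorProduct R (ResidueField R) (LinearMap.ker π)) :=
    ModuleCat.ofHom (g₁.lTensor (ResidueField R))
  have hψ : C.d 2 1 ≫ ψ = 0 := by
    have : g₁ ∘ₗ (P.complex.d 2 1).hom = 0 := by
      ext1 p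
      refine Subtype.ext ?_
      have hd := congr(($(P.complex.d_comp_d 2 1 0)).hom p)
      exact (congr(g₀ $hd)).trans (map_zero g₀)
    refine ModuleCat.hom_ext ?_
    change g₁.lTensor (ResidueField R) ∘ₗ (P.complex.d 2 1).hom.lTensor (ResidueField R) = 0
    rw [← LinearMap.lTensor_comp, this, LinearMap.lTensor_zero]
  let s := C.homologyι 1 ≫ C.descOpcycles ψ 2 (by simp) hψ
  have key (p : P.complex.X 1)
      (hp : (1 : ResidueField R) ⊗ₜ[R] (P.complex.d 1 0).hom p = 0) :
      ∃ z, s.hom z = (1 : ResidueField R) ⊗ₜ[R] g₁ p := by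
    let l : ModuleCat.of R R ⟶ C.X 1 := ModuleCat.ofHom
      (LinearMap.toSpanSingleton R _ ((1 : ResidueField R) ⊗ₜ[R] p))
    have hl : l ≫ C.d 1 0 = 0 := by
      refine ModuleCat.hom_ext (LinearMap.ext_ring ?_)
      change ((P.complex.d 1 0).hom.lTensor (ResidueField R)) ((1 : R) • (1 ⊗ₜ[R] p)) = 0
      rw [one_smul]
      exact hp
    have hs : (C.liftCycles l 0 (by simp) hl ≫ C.homologyπ 1) ≫ s = l ≫ ψ := by
      simp [s]
    refine ⟨(C.liftCycles l 0 (by simp) hl ≫ C.homologyπ 1).hom (1 : R), ?_⟩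
    refine (congr(($hs).hom (1 : R))).trans ?_
    change g₁.lTensor (ResidueField R) ((1 : R) • (1 ⊗ₜ[R] p)) = _
    rw [one_smul]
    rfl
  refine ⟨(e.hom ≫ s).hom, ?_⟩
  suffices Function.Surjective s.hom from
    this.comp e.toLinearEquiv.surjective
  intro t
  obtain ⟨κ, rfl⟩ := TensorProduct.mk_surjective R (LinearMap.ker π) (ResidueField R)
    residue_surjective t
  obtain ⟨p, hp⟩ := (ShortComplex.moduleCat_exact_iff _).mp P.exact₀ (h κ)
    ((hh κ).trans κ.2)
  obtain ⟨z, hz⟩ := key p (by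
    rw [show (P.complex.d 1 0).hom p = h κ from hp]
    exact lTensor_residueField_eq_zero h (hmin κ κ.2))
  refine ⟨z, hz.trans ?_⟩
  let q : (Fin b → R) →ₗ[R] LinearMap.ker π := (g₀ ∘ₗ h - LinearMap.id).codRestrict _ fun v ↦ by
    rw [LinearMap.mem_ker, LinearMap.sub_apply, map_sub, LinearMap.comp_apply, hg₀]
    exact sub_eq_zero.mpr (hh v)
  have hq : g₁ p = κ + q κ := by
    refine Subtype.ext ?_
    change g₀ ((P.complex.d 1 0).hom p) = κ + (g₀ (h κ) - κ)
    rw [show (P.complex.d 1 0).hom p = h κ from hp]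
    abel
  rw [hq, TensorProduct.tmul_add, lTensor_residueField_eq_zero q (hmin κ κ.2), add_zero]
  rfl

/-- A module with Betti numbers `b₀` and `b₁` has a minimal presentation with `b₀` generators and
`b₁` relations. -/
theorem exists_minimal_presentation {R : Type} [CommRing R] [IsNoetherianRing R] [IsLocalRing R]
    {M : ModuleCat.{0} R} [Module.Finite R M] {b₀ b₁ : ℕ} (h₀ : HasBetti R M 0 b₀)
    (h₁ : HasBetti R M 1 b₁) :
    ∃ (π : (Fin b₀ → R) →ₗ[R] M) (w : Fin b₁ → Fin b₀ → R), Function.Surjective π ∧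
      LinearMap.ker π = Submodule.span R (Set.range w) ∧
      ∀ v ∈ LinearMap.ker π, ∀ i, v i ∈ maximalIdeal R := by
  obtain ⟨π, hπ, hmin⟩ := exists_minimal_generators h₀
  obtain ⟨s, hs⟩ := exists_surjective_torM_one π hπ hmin
  obtain ⟨e⟩ := h₁
  obtain ⟨w, -, hw⟩ := exists_span_range_eq_top_of_surjective (s ∘ₗ e.symm.hom.hom)
    (hs.comp e.symm.toLinearEquiv.surjective)
  refine ⟨π, fun j ↦ w j, hπ, ?_, hmin⟩
  have := congr(Submodule.map (LinearMap.ker π).subtype $hw)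
  rw [Submodule.map_span, Submodule.map_subtype_top, ← Set.range_comp] at this
  exact this.symm

open scoped Pointwise in
lemma isWeaklyRegular_pair {R : Type*} [CommRing R] {x y : R} (hx : x ∈ nonZeroDivisors R)
    (hy : IsSMulRegular (R ⧸ Ideal.span {x}) y) : IsWeaklyRegular R [x, y] := by
  have hspan : Ideal.span {x} = x • (⊤ : Ideal R) := by
    simp [← Submodule.ideal_span_singleton_smul]
  rw [isWeaklyRegular_cons_iff, isWeaklyRegular_singleton_iff]
  exact ⟨Module.Flat.isSMulRegular_of_nonZeroDivisors hx,
    ((Submodule.quotEquivOfEq _ _ hspan).isSMulRegular_congr y).mp hy⟩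

/-- An ideal with a minimal system of at least two generators is not principal. -/
lemma range_ne_span_singleton {R : Type*} [CommRing R] [IsLocalRing R] {n : ℕ} (hn : n ≠ 0)
    {f : (Fin (n + 1) → R) →ₗ[R] R}
    (hmin : ∀ v ∈ LinearMap.ker f, ∀ i, v i ∈ maximalIdeal R) (δ : R) :
    LinearMap.range f ≠ Ideal.span {δ} := by
  obtain ⟨n, rfl⟩ := Nat.exists_eq_succ_of_ne_zero hn
  intro h
  obtain ⟨c, hc⟩ : δ ∈ LinearMap.range f := h ▸ Ideal.mem_span_singleton_self δ
  have hex (i) : ∃ r : R, r * δ = f (Pi.single i 1) :=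
    Ideal.mem_span_singleton'.mp (h ▸ LinearMap.mem_range_self f (Pi.single i 1))
  choose r hr using hex
  have hmem (i j) : residue R ((Pi.single i 1 : Fin (n + 1 + 1) → R) j - r i * c j) = 0 := by
    rw [residue_eq_zero_iff]
    exact hmin (Pi.single i 1 - r i • c) (by simp [hc, hr]) j
  have h00 := hmem 0 0
  have h01 := hmem 0 1
  have h11 := hmem 1 1
  simp only [Pi.single_eq_same, map_sub, map_one, map_mul] at h00 h11
  simp only [Pi.single_eq_of_ne (one_ne_zero), map_sub, map_zero, map_mul] at h01
  refine one_ne_zero (α := ResidueField R) ?_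
  linear_combination h00 + residue R (r 0) * residue R (c 0) * h11 -
    residue R (r 1) * residue R (c 0) * h01

lemma one_le_height_of_mem_nonZeroDivisors {R : Type*} [CommRing R] {p : Ideal R} [p.IsPrime]
    {x : R} (hx : x ∈ nonZeroDivisors R) (hxp : x ∈ p) : 1 ≤ p.height := by
  rw [Order.one_le_iff_ne_zero, Ne, Ideal.height_eq_zero_iff]
  intro h
  exact Set.disjoint_left.mp (Ideal.disjoint_nonZeroDivisors_of_mem_minimalPrimes h) hxp hx

/-- Primes of height at most one contain no two elements forming a regular sequence. -/
lemma notMem_of_height_le_one {R : Type*} [CommRing R] [IsNoetherianRing R] {p : Ideal R}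
    [p.IsPrime] (hp : p.height ≤ 1) {x y : R} (hx : x ∈ nonZeroDivisors R) (hxp : x ∈ p)
    (hy : IsSMulRegular (R ⧸ Ideal.span {x}) y) : y ∉ p := by
  intro hyp
  have hmin : p ∈ (Ideal.span {x}).minimalPrimes := by
    refine ⟨⟨‹_›, (Ideal.span_singleton_le_iff_mem p).mpr hxp⟩, fun q ⟨hq, hxq⟩ hle ↦ ?_⟩
    by_contra hnot
    have h₁ := one_le_height_of_mem_nonZeroDivisors hx
      ((Ideal.span_singleton_le_iff_mem q).mp hxq)
    have h₂ := Ideal.height_add_one_le_of_lt_of_isPrime (lt_of_le_not_ge hle hnot)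
    have h₃ := (add_le_add_left h₁ 1).trans (h₂.trans hp)
    norm_num at h₃
  have hass : p ∈ associatedPrimes R (R ⧸ Ideal.span {x}) :=
    Module.associatedPrimes.minimalPrimes_annihilator_subset_associatedPrimes R _
      (by rwa [Ideal.annihilator_quotient])
  obtain ⟨-, s, hs⟩ := isAssociatedPrime_quotient_iff.mp hass
  have := (isSMulRegular_quotient_iff_mem_of_smul_mem _ _).mp hy s ((hs y).mp hyp)
  exact ‹p.IsPrime›.ne_top ((Ideal.eq_top_iff_one p).mpr ((hs 1).mpr (by rwa [one_mul])))

/-- In a Cohen-Macaulay local ring, the unmixed part of `a J` is `(a)` when `a` is a nonzerodivisor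
and `J` has grade at least two. -/
theorem unmixedPart_span_singleton_mul {R : Type} [CommRing R] [IsNoetherianRing R] [IsLocalRing R]
    (hR : IsCMLocalRing R) {a x y : R} {J : Ideal R} (ha : a ∈ nonZeroDivisors R)
    (hau : ¬ IsUnit a) (hxJ : x ∈ J) (hyJ : y ∈ J) (hx : x ∈ nonZeroDivisors R)
    (hy : IsSMulRegular (R ⧸ Ideal.span {x}) y) :
    unmixedPart R (Ideal.span {a} * J) = Ideal.span {a} := by
  set I := Ideal.span {a} * J with hI
  have hIa : I ≤ Ideal.span {a} := Ideal.mul_le_left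
  have hJ (p : Ideal R) [p.IsPrime] (hp : p.height ≤ 1) : ¬ J ≤ p := fun h ↦
    notMem_of_height_le_one hp hx (h hxJ) hy (h hyJ)
  have hone (p : Ideal R) [p.IsPrime] (hp : I ≤ p) : 1 ≤ p.height :=
    one_le_height_of_mem_nonZeroDivisors (mul_mem ha hx)
      (hp (Ideal.mul_mem_mul (Ideal.mem_span_singleton_self a) hxJ))
  have hmin (p : Ideal R) [p.IsPrime] (hp : I ≤ p) (h : p.height ≤ 1) : p ∈ I.minimalPrimes := by
    refine ⟨⟨‹_›, hp⟩, fun q ⟨hq, hIq⟩ hle ↦ ?_⟩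
    by_contra hnot
    have h₁ := hone q hIq
    have h₂ := Ideal.height_add_one_le_of_lt_of_isPrime (lt_of_le_not_ge hle hnot)
    have h₃ := (add_le_add_left h₁ 1).trans (h₂.trans h)
    norm_num at h₃
  have hht : idealHt R I = ((1 : ℕ∞) : WithBot ℕ∞) := by
    refine IsLeast.csInf_eq ⟨?_, ?_⟩
    · have hne : Ideal.span {a} ≠ ⊤ := by rwa [Ne, Ideal.span_singleton_eq_top]
      obtain ⟨p, hp⟩ := Ideal.nonempty_minimalPrimes hne
      have : p.IsPrime := hp.1.1
      have hle : p.height ≤ 1 := Ideal.height_le_one_of_isPrincipal_of_mem_minimalPrimes _ p hp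
      have hIp : I ≤ p := hIa.trans hp.1.2
      refine ⟨⟨p, this⟩, hmin p hIp hle, ?_⟩
      rw [IsLocalization.AtPrime.ringKrullDim_eq_height p, le_antisymm hle (hone p hIp)]
    · rintro _ ⟨p, hp, rfl⟩
      rw [IsLocalization.AtPrime.ringKrullDim_eq_height p.asIdeal]
      exact WithBot.coe_le_coe.mpr (hone _ hp.1.2)
  refine le_antisymm (fun z hz ↦ ?_) ?_
  · by_contra hza
    obtain ⟨p, hp, hle⟩ := exists_le_isAssociatedPrime_of_isNoetherianRing R
      (Ideal.Quotient.mk (Ideal.span {a}) z) (by rwa [Ne, Ideal.Quotient.eq_zero_iff_mem])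
    have := hp.isPrime
    have hcol (r : R) (hr : r * z ∈ Ideal.span {a}) : r ∈ p := by
      apply hle
      rw [Submodule.mem_colon_singleton, Submodule.mem_bot]
      exact Ideal.Quotient.eq_zero_iff_mem.mpr hr
    have hap : Ideal.span {a} ≤ p := fun r hr ↦ hcol r (Ideal.mul_mem_right _ _ hr)
    have hle := height_le_one_of_isAssociatedPrime_quotient_span hR ha hp
    have hIp := hIa.trans hap
    have hmem := (Submodule.mem_iInf _).mp hz ⟨⟨p, this⟩, hmin p hIp hle, by
      rw [IsLocalization.AtPrime.ringKrullDim_eq_height p, hht, le_antisymm hle (hone p hIp)]⟩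
    obtain ⟨s, hs, hsz⟩ := (IsLocalization.algebraMap_mem_map_algebraMap_iff p.primeCompl _ _ _).mp
      (Ideal.mem_comap.mp hmem)
    exact hs (hcol s (hIa hsz))
  · rw [Ideal.span_singleton_le_iff_mem, unmixedPart, Submodule.mem_iInf]
    rintro ⟨p, hp, hph⟩
    rw [IsLocalization.AtPrime.ringKrullDim_eq_height p.asIdeal, hht, WithBot.coe_inj] at hph
    obtain ⟨j, hj, hjp⟩ := Set.not_subset.mp (hJ p.asIdeal hph.le)
    refine Ideal.mem_comap.mpr ((IsLocalization.algebraMap_mem_map_algebraMap_iff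
      p.asIdeal.primeCompl _ _ _).mpr ⟨j, hjp, ?_⟩)
    rw [mul_comm]
    exact Ideal.mul_mem_mul (Ideal.mem_span_singleton_self a) hj

theorem stmt9 (R : Type) [CommRing R] [IsNoetherianRing R] [IsLocalRing R]
    (hGor : IsGorensteinLocalRing R)
    (I : Ideal R) (b0 b1 : ℕ) (hb0 : HasBetti R (ModuleCat.of R I) 0 b0)
    (hb1 : HasBetti R (ModuleCat.of R I) 1 b1)
    (hdiff : (b1 : ℤ) - (b0 : ℤ) = -1) (hb1ne : b1 ≠ 0)
    (hgrade : GradeEq R I 1) :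
    (∃ δ : R, δ ∈ nonZeroDivisors R ∧ unmixedPart R I = Ideal.span {δ}) ∧
      I ≠ unmixedPart R I := by
  obtain ⟨π, w, hπ, hker, hmin⟩ := exists_minimal_presentation hb0 hb1
  obtain rfl : b0 = b1 + 1 := by omega
  let f : (Fin (b1 + 1) → R) →ₗ[R] R := I.subtype ∘ₗ π
  have hfπ : LinearMap.ker f = LinearMap.ker π :=
    LinearMap.ker_comp_of_ker_eq_bot _ I.ker_subtype
  have hrange : LinearMap.range f = I := by
    rw [LinearMap.range_comp_of_range_eq_top _ (LinearMap.range_eq_top.mpr hπ), I.range_subtype]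
  have hprin (δ : R) : I ≠ Ideal.span {δ} :=
    hrange ▸ range_ne_span_singleton hb1ne (hfπ ▸ hmin) δ
  have hIm : I ≤ maximalIdeal R := le_maximalIdeal fun h ↦ hprin 1 (by simp [h])
  obtain ⟨⟨rs, hlen, hrsI, hrs⟩, hub⟩ := hgrade
  obtain ⟨c, hc⟩ : ∃ c, f c ∈ nonZeroDivisors R := by
    obtain ⟨r, rfl⟩ := List.length_eq_one_iff.mp hlen
    obtain ⟨c, hc⟩ : r ∈ LinearMap.range f := hrange ▸ hrsI r (by simp)
    exact ⟨c, hc ▸ isRegular_iff_mem_nonZeroDivisors.mp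
      (isLeftRegular_iff_isRegular.mp ((isRegular_cons_iff _ _ _).mp hrs).1)⟩
  obtain ⟨a, ha, hfa, x, hxJ, hx, y, hyJ, hy⟩ := exists_eq_smul_signedMinors (hfπ.trans hker) hc
  let J : Ideal R := LinearMap.range (signedMinors w)
  have hIJ : I = Ideal.span {a} * J := by
    ext z
    rw [← hrange, hfa, Ideal.mem_span_singleton_mul]
    simp [J]
  have hau : ¬ IsUnit a := by
    intro hu
    have hJ : J = I := by rw [hIJ, Ideal.span_singleton_eq_top.mpr hu, Ideal.top_mul]
    have hmem : ∀ z ∈ [x, y], z ∈ I := by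
      simp only [List.mem_cons, List.not_mem_nil, or_false, forall_eq_or_imp, forall_eq, ← hJ]
      exact ⟨hxJ, hyJ⟩
    have hreg : IsRegular R [x, y] := IsRegular.of_isWeaklyRegular_of_mem_maximalIdeal R
      (fun z hz ↦ hIm (hmem z hz)) (isWeaklyRegular_pair hx hy)
    simpa using hub _ hmem hreg
  have hun : unmixedPart R I = Ideal.span {a} := by
    rw [hIJ]
    exact unmixedPart_span_singleton_mul hGor.1 ha hau hxJ hyJ hx hy
  exact ⟨⟨a, ha, hun⟩, hun ▸ hprin a⟩
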